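/- Let l ≥ 2 be an integer and 0 < p < 1. For k ≥ 1 and t ≥ l set I_k(t) = p(l−1)/l + (1−p)(2t−k)/(2t) and L_{k−1}(t) = p/l + (1−p)(k−1)/(2t). Let q(t,m,k) (t ≥ l, 1 ≤ m ≤ l, k ≥ 1) satisfy: q(t,l,1) = 1 and q(t,l,k) = 0 for all k ≥ 2 and all t ≥ l; q(l,m,1) = 1 and q(l,m,k) = 0 for all k ≥ 2 and all 1 ≤ m ≤ l; and for all t ≥ l and 1 ≤ m < l: q(t+1,m,1) = I₁(t)·q(t,m+1,1), and for k ≥ 2, q(t+1,m,k) = I_k(t)·q(t,m+1,k) + L_{k−1}(t)·q(t,m+1,k−1). Then for every integer k with 1 ≤ k ≤ l, the limit H_k = lim_{t→∞} Σ_{m=1}^{l} q(t,m,k) exists and equals (p/l)^{k−1}·Σ_{m=1}^{l−(k−1)} C(l−m, l−m−(k−1))·(1−p/l)^{l−m−(k−1)}, where C(n,j) denotes the binomial coefficient; and for every k > l, Σ_{m=1}^{l} q(t,m,k) = 0 for all t ≥ l. -/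

import Mathlib

open Filter Finset

/-- The quantity `H_k` of the UPA model with window size `l`:
`H_k = (p/l)^{k-1} Σ_{m=1}^{l-(k-1)} C(l-m, l-m-(k-1)) (1-p/l)^{l-m-(k-1)}` for `1 ≤ k ≤ l`. -/
noncomputable def Hupa (l : ℕ) (p : ℝ) (k : ℕ) : ℝ :=
  (p / l) ^ (k - 1) *
    ∑ m ∈ Finset.Icc 1 (l - (k - 1)),
      ((l - m).choose (l - m - (k - 1)) : ℝ) * (1 - p / l) ^ (l - m - (k - 1))

theorem stmt_9 (l : ℕ) (hl : 2 ≤ l) (p : ℝ) (hp0 : 0 < p) (hp1 : p < 1)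
    (q : ℕ → ℕ → ℕ → ℝ)
    (hql1 : ∀ t : ℕ, l ≤ t → q t l 1 = 1)
    (hqlk : ∀ t : ℕ, l ≤ t → ∀ k : ℕ, 2 ≤ k → q t l k = 0)
    (hqinit1 : ∀ m : ℕ, 1 ≤ m → m ≤ l → q l m 1 = 1)
    (hqinitk : ∀ m : ℕ, 1 ≤ m → m ≤ l → ∀ k : ℕ, 2 ≤ k → q l m k = 0)
    (hqrec1 : ∀ t : ℕ, l ≤ t → ∀ m : ℕ, 1 ≤ m → m < l →
      q (t + 1) m 1 = (p * ((l : ℝ) - 1) / l + (1 - p) * (2 * t - 1) / (2 * t)) * q t (m + 1) 1)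
    (hqreck : ∀ t : ℕ, l ≤ t → ∀ m : ℕ, 1 ≤ m → m < l → ∀ k : ℕ, 2 ≤ k →
      q (t + 1) m k
        = (p * ((l : ℝ) - 1) / l + (1 - p) * (2 * t - k) / (2 * t)) * q t (m + 1) k
          + (p / l + (1 - p) * ((k : ℝ) - 1) / (2 * t)) * q t (m + 1) (k - 1)) :
    (∀ k : ℕ, 1 ≤ k → k ≤ l →
      Tendsto (fun t : ℕ => ∑ m ∈ Finset.Icc 1 l, q t m k) atTop (nhds (Hupa l p k))) ∧
    (∀ k : ℕ, l < k → ∀ t : ℕ, l ≤ t → ∑ m ∈ Finset.Icc 1 l, q t m k = 0) := by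
  have hl0 : (l : ℝ) ≠ 0 := by positivity
  have hinv : Tendsto (fun t : ℕ => ((t : ℝ))⁻¹) atTop (nhds 0) :=
    tendsto_inv_atTop_nhds_zero_nat
  have hI : ∀ c : ℝ, Tendsto (fun t : ℕ => p * ((l : ℝ) - 1) / l + (1 - p) * (2 * t - c) / (2 * t))
      atTop (nhds (1 - p / l)) := by
    intro c
    have h : Tendsto (fun t : ℕ => (1 - p / l) - ((1 - p) * c / 2) * ((t : ℝ))⁻¹) atTop
        (nhds ((1 - p / l) - ((1 - p) * c / 2) * 0)) := (hinv.const_mul _).const_sub _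
    rw [mul_zero, sub_zero] at h
    refine h.congr' ?_
    filter_upwards [eventually_ge_atTop 1] with t ht
    have ht0 : (t : ℝ) ≠ 0 := by positivity
    field_simp
    ring
  have hL : ∀ c : ℝ, Tendsto (fun t : ℕ => p / l + (1 - p) * c / (2 * t))
      atTop (nhds (p / l)) := by
    intro c
    have h : Tendsto (fun t : ℕ => p / l + ((1 - p) * c / 2) * ((t : ℝ))⁻¹) atTop
        (nhds (p / l + ((1 - p) * c / 2) * 0)) := (hinv.const_mul _).const_add _
    rw [mul_zero, add_zero] at h
    refine h.congr' ?_
    filter_upwards [eventually_ge_atTop 1] with t ht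
    have ht0 : (t : ℝ) ≠ 0 := by positivity
    field_simp
  have key : ∀ j m : ℕ, 1 ≤ m → m + j = l → ∀ k : ℕ,
      Tendsto (fun t : ℕ => q t m (k + 1)) atTop
        (nhds ((j.choose k : ℝ) * (p / l) ^ k * (1 - p / l) ^ (j - k))) := by
    intro j
    induction j with
    | zero =>
      intro m hm hml k
      obtain rfl : m = l := by omega
      rcases k with _ | k
      · refine tendsto_const_nhds.congr' ?_
        filter_upwards [eventually_ge_atTop m] with t ht
        rw [hql1 t ht]; simp
      · refine tendsto_const_nhds.congr' ?_
        filter_upwards [eventually_ge_atTop m] with t ht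
        rw [hqlk t ht _ (by omega)]; simp
    | succ j ih =>
      intro m hm hml k
      have ih' := ih (m + 1) (by omega) (by omega)
      rw [← tendsto_add_atTop_iff_nat 1]
      rcases k with _ | k
      · have h := (hI 1).mul (ih' 0)
        have e : (1 - p / l) * ((j.choose 0 : ℝ) * (p / l) ^ 0 * (1 - p / l) ^ (j - 0))
            = (((j + 1).choose 0 : ℕ) : ℝ) * (p / l) ^ 0 * (1 - p / l) ^ (j + 1 - 0) := by
          simp [pow_succ]; ring
        rw [e] at h
        refine h.congr' ?_
        filter_upwards [eventually_ge_atTop l] with t ht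
        exact (hqrec1 t ht m hm (by omega)).symm
      · have h := ((hI ((k + 1 + 1 : ℕ) : ℝ)).mul (ih' (k + 1))).add
          ((hL (((k + 1 + 1 : ℕ) : ℝ) - 1)).mul (ih' k))
        have e : (1 - p / l) * ((j.choose (k + 1) : ℝ) * (p / l) ^ (k + 1)
              * (1 - p / l) ^ (j - (k + 1)))
            + p / l * ((j.choose k : ℝ) * (p / l) ^ k * (1 - p / l) ^ (j - k))
            = (((j + 1).choose (k + 1) : ℕ) : ℝ) * (p / l) ^ (k + 1)
              * (1 - p / l) ^ (j + 1 - (k + 1)) := by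
          rw [Nat.choose_succ_succ, Nat.add_sub_add_right]
          push_cast
          rcases Nat.lt_or_ge k j with hkj | hkj
          · have : j - k = (j - (k + 1)) + 1 := by omega
            rw [this]; ring
          · rw [Nat.choose_eq_zero_of_lt (show j < k + 1 by omega)]
            push_cast; ring
        rw [e] at h
        refine h.congr' ?_
        filter_upwards [eventually_ge_atTop l] with t ht
        exact (hqreck t ht m hm (by omega) (k + 1 + 1) (by omega)).symm
  have hzero : ∀ j m : ℕ, 1 ≤ m → m + j = l → ∀ k : ℕ, j + 1 < k → ∀ t, l ≤ t → q t m k = 0 := by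
    intro j
    induction j with
    | zero =>
      intro m hm hml k hk t ht
      obtain rfl : m = l := by omega
      exact hqlk t ht k (by omega)
    | succ j ih =>
      intro m hm hml k hk t ht
      rcases Nat.eq_or_lt_of_le ht with rfl | ht'
      · exact hqinitk m hm (by omega) k (by omega)
      · obtain ⟨s, rfl⟩ : ∃ s, t = s + 1 := ⟨t - 1, by omega⟩
        rw [hqreck s (by omega) m hm (by omega) k (by omega),
          ih (m + 1) (by omega) (by omega) k (by omega) s (by omega),
          ih (m + 1) (by omega) (by omega) (k - 1) (by omega) s (by omega)]
        ring
  refine ⟨?_, ?_⟩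
  · intro k hk hkl
    obtain ⟨k, rfl⟩ : ∃ s, k = s + 1 := ⟨k - 1, by omega⟩
    have h : Tendsto (fun t : ℕ => ∑ m ∈ Finset.Icc 1 l, q t m (k + 1)) atTop
        (nhds (∑ m ∈ Finset.Icc 1 l,
          (((l - m).choose k : ℝ) * (p / l) ^ k * (1 - p / l) ^ (l - m - k)))) := by
      refine tendsto_finsetSum _ fun m hm => ?_
      rw [Finset.mem_Icc] at hm
      exact key (l - m) m hm.1 (by omega) k
    convert h using 2
    unfold Hupa
    rw [Nat.add_sub_cancel, Finset.mul_sum]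
    rw [← Finset.sum_subset (Finset.Icc_subset_Icc_right (Nat.sub_le l k) :
      Finset.Icc 1 (l - k) ⊆ Finset.Icc 1 l)]
    · refine Finset.sum_congr rfl fun m hm => ?_
      rw [Finset.mem_Icc] at hm
      rw [Nat.choose_symm (show k ≤ l - m by omega)]
      ring
    · intro m hm hm'
      rw [Finset.mem_Icc] at hm hm'
      rw [Nat.choose_eq_zero_of_lt (show l - m < k by omega)]
      simp
  · intro k hk t ht
    refine Finset.sum_eq_zero fun m hm => ?_
    rw [Finset.mem_Icc] at hm
    exact hzero (l - m) m hm.1 (by omega) k (by omega) t ht
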